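/- Let A and B be crossing mincuts with r ∉ A, and suppose A is the minimal mincut of an edge e = {x,y}. Then e has exactly one endpoint in A ∩ B and the other endpoint in A ∖ B; consequently A is the union of the chain (A∖B, A∩B) or (A∩B, A∖B), so A has a chain certificate. -/

import Mathlib

open Finset

variable {V : Type*} [Fintype V] [DecidableEq V]

/-- `cutW w X Y` is `C(X,Y) = Σ_{x∈X} Σ_{y∈Y} w(x,y)`. -/
def cutW (w : V → V → ℝ) (X Y : Finset V) : ℝ := ∑ x ∈ X, ∑ y ∈ Y, w x y

/-- `C(X) := C(X, V ∖ X)`. -/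
def cutVal (w : V → V → ℝ) (X : Finset V) : ℝ := cutW w X Xᶜ

/-- A cut is a nonempty proper subset of `V`. -/
def IsCut (X : Finset V) : Prop := X.Nonempty ∧ X ≠ Finset.univ

/-- A mincut is a cut of minimum weight. -/
def IsMincut (w : V → V → ℝ) (X : Finset V) : Prop :=
  IsCut X ∧ ∀ Y : Finset V, IsCut Y → cutVal w X ≤ cutVal w Y

/-- `X` and `Y` cross if `X∩Y`, `X∖Y`, `Y∖X` and `V∖(X∪Y)` are all nonempty. -/
def Crosses (X Y : Finset V) : Prop :=
  (X ∩ Y).Nonempty ∧ (X \ Y).Nonempty ∧ (Y \ X).Nonempty ∧ ((X ∪ Y)ᶜ).Nonempty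

/-- A minimal mincut of a vertex `v`: a mincut containing `v` but not the root `r`,
of minimum cardinality among all such mincuts. -/
def IsMinimalMincutOfVertex (w : V → V → ℝ) (r v : V) (X : Finset V) : Prop :=
  IsMincut w X ∧ v ∈ X ∧ r ∉ X ∧
    ∀ Y : Finset V, IsMincut w Y → v ∈ Y → r ∉ Y → X.card ≤ Y.card

/-- An edge is an unordered pair of distinct vertices with positive weight. -/
def IsEdge (w : V → V → ℝ) (u₁ u₂ : V) : Prop := u₁ ≠ u₂ ∧ 0 < w u₁ u₂

/-- A minimal mincut of an edge `{u₁,u₂}`: a mincut containing both endpoints but not the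
root `r`, of minimum cardinality among all such mincuts. -/
def IsMinimalMincutOfEdge (w : V → V → ℝ) (r u₁ u₂ : V) (X : Finset V) : Prop :=
  IsEdge w u₁ u₂ ∧ IsMincut w X ∧ u₁ ∈ X ∧ u₂ ∈ X ∧ r ∉ X ∧
    ∀ Y : Finset V, IsMincut w Y → u₁ ∈ Y → u₂ ∈ Y → r ∉ Y → X.card ≤ Y.card

/-- Union of the members of a chain. -/
def chainUnion (C : List (Finset V)) : Finset V := C.foldr (· ∪ ·) ∅

/-- `X ⊆ V∖{r}` has a certificate if it is the minimal mincut of some vertex,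
the minimal mincut of some edge, or the union of a chain, where a chain is a sequence
`(C₀,…,C_ℓ)` (`ℓ ≥ 1`) of pairwise disjoint nonempty subsets of `V∖{r}` such that every
`C_i` has a certificate and each `C_i ∪ C_{i+1}` is the minimal mincut of some edge. -/
inductive HasCert (w : V → V → ℝ) (r : V) : Finset V → Prop
  | vertex {v : V} {X : Finset V} : IsMinimalMincutOfVertex w r v X → HasCert w r X
  | edge {u₁ u₂ : V} {X : Finset V} : IsMinimalMincutOfEdge w r u₁ u₂ X → HasCert w r X
  | chain {C : List (Finset V)} :
      2 ≤ C.length →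
      (∀ A ∈ C, A.Nonempty) →
      (∀ A ∈ C, r ∉ A) →
      C.Pairwise (fun A B => Disjoint A B) →
      (∀ A ∈ C, HasCert w r A) →
      (∀ i (h : i + 1 < C.length),
        ∃ u₁ u₂, IsMinimalMincutOfEdge w r u₁ u₂
          (C.get ⟨i, Nat.lt_of_succ_lt h⟩ ∪ C.get ⟨i + 1, h⟩)) →
      HasCert w r (chainUnion C)

/-- `(C₀,…,C_ℓ)` with `ℓ ≥ 1` is a chain. -/
def IsMincutChain (w : V → V → ℝ) (r : V) (C : List (Finset V)) : Prop :=
  2 ≤ C.length ∧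
  (∀ A ∈ C, A.Nonempty) ∧
  (∀ A ∈ C, r ∉ A) ∧
  C.Pairwise (fun A B => Disjoint A B) ∧
  (∀ A ∈ C, HasCert w r A) ∧
  (∀ i (h : i + 1 < C.length),
    ∃ u₁ u₂, IsMinimalMincutOfEdge w r u₁ u₂
      (C.get ⟨i, Nat.lt_of_succ_lt h⟩ ∪ C.get ⟨i + 1, h⟩))

/-- A subchain is a consecutive subsequence of a chain or of its reversal. -/
def IsSubchain (D C : List (Finset V)) : Prop := D <:+: C ∨ D <:+: C.reverse

/-- A maximal chain is a chain that is not a subchain of any strictly longer chain. -/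
def IsMaximalMincutChain (w : V → V → ℝ) (r : V) (C : List (Finset V)) : Prop :=
  IsMincutChain w r C ∧
    ¬ ∃ D : List (Finset V), IsMincutChain w r D ∧ C.length < D.length ∧ IsSubchain C D

/-- `lam` is the minimum weight of a cut. -/
def IsMincutValue (w : V → V → ℝ) (lam : ℝ) : Prop :=
  (∃ X : Finset V, IsCut X ∧ cutVal w X = lam) ∧
  ∀ X : Finset V, IsCut X → lam ≤ cutVal w X

section helpers

theorem cutW_eq_ite (w : V → V → ℝ) (X Y : Finset V) :
    cutW w X Y = ∑ x, ∑ y, if x ∈ X ∧ y ∈ Y then w x y else 0 := by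
  unfold cutW
  rw [← Finset.sum_filter_add_sum_filter_not Finset.univ (fun x => x ∈ X)]
  have h2 : ∑ x ∈ Finset.univ.filter (fun x => x ∉ X),
      ∑ y, (if x ∈ X ∧ y ∈ Y then w x y else 0) = 0 := by
    apply Finset.sum_eq_zero
    intro x hx
    apply Finset.sum_eq_zero
    intro y _
    simp at hx
    simp [hx]
  rw [h2, add_zero, Finset.filter_univ_mem]
  apply Finset.sum_congr rfl
  intro x hx
  simp [hx]

theorem cutW_symm (w : V → V → ℝ) (hsym : ∀ x y, w x y = w y x) (X Y : Finset V) :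
    cutW w X Y = cutW w Y X := by
  unfold cutW
  rw [Finset.sum_comm]
  simp only [hsym]

theorem cutVal_compl (w : V → V → ℝ) (hsym : ∀ x y, w x y = w y x) (X : Finset V) :
    cutVal w Xᶜ = cutVal w X := by
  unfold cutVal
  rw [cutW_symm w hsym, compl_compl]

theorem cutVal_submod (w : V → V → ℝ) (hnonneg : ∀ x y, 0 ≤ w x y) (S T : Finset V) :
    cutVal w (S ∩ T) + cutVal w (S ∪ T) ≤ cutVal w S + cutVal w T := by
  unfold cutVal
  simp only [cutW_eq_ite, ← Finset.sum_add_distrib]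
  apply Finset.sum_le_sum
  intro x _
  apply Finset.sum_le_sum
  intro y _
  have := hnonneg x y
  by_cases h1 : x ∈ S <;> by_cases h2 : x ∈ T <;> by_cases h3 : y ∈ S <;>
    by_cases h4 : y ∈ T <;> simp [h1, h2, h3, h4, this]

theorem cutVal_union (w : V → V → ℝ) (hsym : ∀ x y, w x y = w y x) (P Q : Finset V)
    (h : Disjoint P Q) :
    cutVal w (P ∪ Q) + 2 * cutW w P Q = cutVal w P + cutVal w Q := by
  have : cutVal w (P ∪ Q) + (cutW w P Q + cutW w Q P) = cutVal w P + cutVal w Q := by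
    unfold cutVal
    simp only [cutW_eq_ite, ← Finset.sum_add_distrib]
    apply Finset.sum_congr rfl
    intro x _
    apply Finset.sum_congr rfl
    intro y _
    have hx : x ∈ P → x ∉ Q := fun a b => Finset.disjoint_left.1 h a b
    have hy : y ∈ P → y ∉ Q := fun a b => Finset.disjoint_left.1 h a b
    by_cases h1 : x ∈ P <;> by_cases h2 : x ∈ Q <;> by_cases h3 : y ∈ P <;>
      by_cases h4 : y ∈ Q <;> simp_all
  rw [cutW_symm w hsym Q P] at this
  linarith

theorem exists_edge_of_cutW_pos (w : V → V → ℝ) (P Q : Finset V) (h : 0 < cutW w P Q) :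
    ∃ a ∈ P, ∃ b ∈ Q, 0 < w a b := by
  by_contra hc
  push Not at hc
  have : cutW w P Q ≤ 0 :=
    Finset.sum_nonpos fun a ha => Finset.sum_nonpos fun b hb => hc a ha b hb
  linarith

theorem IsMincut.compl {w : V → V → ℝ} (hsym : ∀ x y, w x y = w y x) {X : Finset V}
    (h : IsMincut w X) : IsMincut w Xᶜ := by
  refine ⟨⟨?_, ?_⟩, ?_⟩
  · rw [Finset.nonempty_iff_ne_empty, Ne, Finset.compl_eq_empty_iff]
    exact h.1.2
  · rw [Ne, Finset.compl_eq_univ_iff]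
    exact h.1.1.ne_empty
  · rw [cutVal_compl w hsym]
    exact h.2

theorem cross_inter_union {w : V → V → ℝ} (hnonneg : ∀ x y, 0 ≤ w x y) {S T : Finset V}
    (hS : IsMincut w S) (hT : IsMincut w T) (h1 : (S ∩ T).Nonempty) (h2 : ∃ v, v ∉ S ∪ T) :
    IsMincut w (S ∩ T) ∧ IsMincut w (S ∪ T) := by
  obtain ⟨v, hv⟩ := h2
  have c1 : IsCut (S ∩ T) := ⟨h1, fun h => by
    have : v ∈ S ∩ T := h ▸ Finset.mem_univ v
    simp at hv this
    exact hv.1 this.1⟩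
  have c2 : IsCut (S ∪ T) := ⟨h1.mono (Finset.inter_subset_left.trans Finset.subset_union_left), fun h => hv (h ▸ Finset.mem_univ v)⟩
  have hs := cutVal_submod w hnonneg S T
  have e1 := hS.2 _ c1
  have e2 := hT.2 _ c2
  have e3 := hS.2 _ hT.1
  have e4 := hT.2 _ hS.1
  refine ⟨⟨c1, fun Y hY => ?_⟩, ⟨c2, fun Y hY => ?_⟩⟩
  · have := hS.2 _ hY
    linarith
  · have := hS.2 _ hY
    linarith

theorem cross_diff {w : V → V → ℝ} (hsym : ∀ x y, w x y = w y x)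
    (hnonneg : ∀ x y, 0 ≤ w x y) {S T : Finset V}
    (hS : IsMincut w S) (hT : IsMincut w T) (h1 : (S \ T).Nonempty) (h2 : (T \ S).Nonempty) :
    IsMincut w (S \ T) := by
  obtain ⟨v, hv⟩ := h2
  have e : S \ T = S ∩ Tᶜ := by
    ext v
    simp
  rw [e] at h1 ⊢
  refine (cross_inter_union hnonneg hS (hT.compl hsym) h1 ⟨v, ?_⟩).1
  simp at hv ⊢
  exact ⟨hv.2, hv.1⟩

/-- If `X` is not minimum among the mincuts containing `S` and avoiding `r`, there is a mincut
strictly inside `X` containing `S`. -/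
theorem exists_sub_mincut {w : V → V → ℝ} (hnonneg : ∀ x y, 0 ≤ w x y) {r a b : V}
    {X Y : Finset V} (hX : IsMincut w X) (hr : r ∉ X) (ha : a ∈ X) (hb : b ∈ X)
    (hY : IsMincut w Y) (hrY : r ∉ Y) (haY : a ∈ Y) (hbY : b ∈ Y) (hc : Y.card < X.card) :
    ∃ M, IsMincut w M ∧ M ⊂ X ∧ a ∈ M ∧ b ∈ M := by
  refine ⟨X ∩ Y, (cross_inter_union hnonneg hX hY ⟨a, by grind⟩ ⟨r, by grind⟩).1, ?_,
    by grind, by grind⟩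
  refine Finset.ssubset_iff_subset_ne.2 ⟨Finset.inter_subset_left, fun h => ?_⟩
  have : X ⊆ Y := Finset.inter_eq_left.1 h
  have := Finset.card_le_card this
  omega

/-- A mincut without vertex or edge certificate splits into two disjoint mincuts. -/
theorem exists_split {w : V → V → ℝ} (hsym : ∀ x y, w x y = w y x)
    (hnonneg : ∀ x y, 0 ≤ w x y) {r : V} {X : Finset V} (hX : IsMincut w X) (hr : r ∉ X)
    (hpos : 0 < cutVal w X)
    (hv : ∀ v, ¬ IsMinimalMincutOfVertex w r v X)
    (hE : ∀ a b, ¬ IsMinimalMincutOfEdge w r a b X) :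
    ∃ P Q, IsMincut w P ∧ IsMincut w Q ∧ Disjoint P Q ∧ P ∪ Q = X := by
  classical
  obtain ⟨v, hvX⟩ := hX.1.1
  have h0 : ∃ M, IsMincut w M ∧ M ⊂ X := by
    have := hv v
    unfold IsMinimalMincutOfVertex at this
    push Not at this
    obtain ⟨Y, hY, hvY, hrY, hc⟩ := this hX hvX hr
    obtain ⟨M, h1, h2, _⟩ := exists_sub_mincut hnonneg hX hr hvX hvX hY hrY hvY hvY hc
    exact ⟨M, h1, h2⟩
  obtain ⟨Y, hYm, hYmax⟩ := Finset.exists_max_image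
    (Finset.univ.filter (fun M => IsMincut w M ∧ M ⊂ X)) Finset.card
    (by obtain ⟨M, hM⟩ := h0; exact ⟨M, by simp [hM]⟩)
  simp only [Finset.mem_filter, Finset.mem_univ, true_and] at hYm hYmax
  obtain ⟨hY, hYX⟩ := hYm
  have hne : (X \ Y).Nonempty := Finset.sdiff_nonempty.2 hYX.2
  have hcut : IsCut (X \ Y) := ⟨hne, fun h => by
    have : r ∈ X \ Y := h ▸ Finset.mem_univ r
    grind⟩
  have hun : Y ∪ (X \ Y) = X := Finset.union_sdiff_of_subset hYX.1
  have hu := cutVal_union w hsym Y (X \ Y) Finset.disjoint_sdiff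
  rw [hun] at hu
  have e1 := hX.2 _ hcut
  have e2 := hX.2 _ hY.1
  obtain ⟨a, ha, b, hb, hab⟩ := exists_edge_of_cutW_pos w Y (X \ Y) (by linarith)
  have haX := hYX.1 ha
  have hbX : b ∈ X := by grind
  have hbY : b ∉ Y := by grind
  have hedge : IsEdge w a b := ⟨by rintro rfl; exact hbY ha, hab⟩
  have := hE a b
  unfold IsMinimalMincutOfEdge at this
  push Not at this
  obtain ⟨Z, hZ, haZ, hbZ, hrZ, hc⟩ := this hedge hX haX hbX hr
  obtain ⟨M, hM, hMX, haM, hbM⟩ := exists_sub_mincut hnonneg hX hr haX hbX hZ hrZ haZ hbZ hc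
  have hrY : r ∉ Y := fun h => hr (hYX.1 h)
  have hrM : r ∉ M := fun h => hr (hMX.1 h)
  have hUn := (cross_inter_union hnonneg hY hM ⟨a, by grind⟩ ⟨r, by grind⟩).2
  have hUX : Y ∪ M = X := by
    by_contra hne
    have h1 := hYmax (Y ∪ M) ⟨hUn, Finset.ssubset_iff_subset_ne.2
      ⟨Finset.union_subset hYX.1 hMX.1, hne⟩⟩
    have h2 : Y.card < (Y ∪ M).card := Finset.card_lt_card
      (Finset.ssubset_iff_of_subset Finset.subset_union_left |>.2 ⟨b, by grind, hbY⟩)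
    omega
  have hYM : (Y \ M).Nonempty := by
    rw [Finset.sdiff_nonempty]
    intro h
    have : Y ∪ M = M := Finset.union_eq_right.2 h
    rw [this] at hUX
    exact hMX.ne hUX
  refine ⟨Y, M \ Y, hY, cross_diff hsym hnonneg hM hY ⟨b, by grind⟩ hYM,
    Finset.disjoint_sdiff, ?_⟩
  rw [Finset.union_sdiff_self_eq_union, hUX]

theorem mem_chainUnion (L : List (Finset V)) (v : V) :
    v ∈ chainUnion L ↔ ∃ A ∈ L, v ∈ A := by
  induction L with
  | nil => simp [chainUnion]
  | cons a l ih =>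
    have : chainUnion (a :: l) = a ∪ chainUnion l := rfl
    simp [this, ih]

/-- Weak chains. -/
def WChain (w : V → V → ℝ) (X : Finset V) (L : List (Finset V)) : Prop :=
  (∀ A ∈ L, IsMincut w A) ∧ L.Pairwise (fun A B => Disjoint A B) ∧
  L.IsChain (fun A B => IsMincut w (A ∪ B)) ∧ (∀ v, v ∈ X ↔ ∃ A ∈ L, v ∈ A)

theorem WChain.length_le {w : V → V → ℝ} {X : Finset V} {L : List (Finset V)}
    (h : WChain w X L) : L.length ≤ Fintype.card V := by
  obtain ⟨h1, h2, -, -⟩ := h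
  have : L.length ≤ (chainUnion L).card := by
    induction L with
    | nil => simp
    | cons a l ih =>
      have e : chainUnion (a :: l) = a ∪ chainUnion l := rfl
      rw [List.pairwise_cons] at h2
      have hd : Disjoint a (chainUnion l) := by
        rw [Finset.disjoint_left]
        intro v hv hv'
        rw [mem_chainUnion] at hv'
        obtain ⟨A, hA, hvA⟩ := hv'
        exact Finset.disjoint_left.1 (h2.1 A hA) hv hvA
      rw [e, Finset.card_union_of_disjoint hd, List.length_cons]
      have := ih (fun A hA => h1 A (by simp [hA])) h2.2
      have := (h1 a (by simp)).1.1.card_pos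
      omega
  exact this.trans (Finset.card_le_univ _)

theorem WChain.reverse {w : V → V → ℝ} {X : Finset V} {L : List (Finset V)}
    (h : WChain w X L) : WChain w X L.reverse := by
  obtain ⟨h1, h2, h3, h4⟩ := h
  refine ⟨by simpa using h1, ?_, ?_, by simpa using h4⟩
  · rw [List.pairwise_reverse]
    exact h2.imp fun h => h.symm
  · rw [List.isChain_reverse]
    exact h3.imp fun a b h => by rwa [Finset.union_comm]

theorem WChain.refine {w : V → V → ℝ} (hsym : ∀ x y, w x y = w y x)
    (hnonneg : ∀ x y, 0 ≤ w x y) {r : V} {X : Finset V} (hr : r ∉ X)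
    {l₁ l₂ : List (Finset V)} {P Q M : Finset V}
    (h : WChain w X (l₁ ++ P :: Q :: l₂)) (hM : IsMincut w M) (hMsub : M ⊆ P ∪ Q)
    (hMP : (P ∩ M).Nonempty) (hMQ : (M ∩ Q).Nonempty) (hPM : (P \ M).Nonempty) :
    WChain w X (l₁ ++ (P \ M) :: (P ∩ M) :: Q :: l₂) := by
  obtain ⟨h1, h2, h3, h4⟩ := h
  have hP : IsMincut w P := h1 P (by simp)
  have hQ : IsMincut w Q := h1 Q (by simp)
  have hPX : ∀ v ∈ P, v ∈ X := fun v hv => (h4 v).2 ⟨P, by simp, hv⟩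
  have hQX : ∀ v ∈ Q, v ∈ X := fun v hv => (h4 v).2 ⟨Q, by simp, hv⟩
  simp only [List.pairwise_append, List.pairwise_cons, List.mem_cons] at h2
  obtain ⟨p1, ⟨p2, p3, p4⟩, p5⟩ := h2
  have hPQ : Disjoint P Q := p2 Q (Or.inl rfl)
  have hPQ' := Finset.disjoint_left.1 hPQ
  obtain ⟨q, hq⟩ := hMQ
  obtain ⟨p, hp⟩ := hMP
  have hrP : r ∉ P := fun h => hr (hPX _ h)
  have hrQ : r ∉ Q := fun h => hr (hQX _ h)
  have hrM : r ∉ M := fun h => (Finset.mem_union.1 (hMsub h)).elim hrP hrQ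
  have hqM : q ∈ M := (Finset.mem_inter.1 hq).1
  have hqP : q ∉ P := fun h => hPQ' h (Finset.mem_inter.1 hq).2
  have hdiff : IsMincut w (P \ M) :=
    cross_diff hsym hnonneg hP hM hPM ⟨q, Finset.mem_sdiff.2 ⟨hqM, hqP⟩⟩
  have hint : IsMincut w (P ∩ M) :=
    (cross_inter_union hnonneg hP hM ⟨p, hp⟩ ⟨r, by grind⟩).1
  have hunion : IsMincut w ((P ∩ M) ∪ Q) := by
    have e : (P ∩ M) ∪ Q = M ∪ Q := by
      ext v
      have := @hMsub v
      grind
    rw [e]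
    exact (cross_inter_union hnonneg hM hQ ⟨q, hq⟩ ⟨r, by grind⟩).2
  have hself : IsMincut w ((P \ M) ∪ (P ∩ M)) := by
    have e : (P \ M) ∪ (P ∩ M) = P := Finset.sdiff_union_inter P M
    rwa [e]
  rw [List.isChain_append] at h3
  obtain ⟨c1, c2, c3⟩ := h3
  rw [List.isChain_cons_cons] at c2
  refine ⟨?_, ?_, ?_, ?_⟩
  · intro A hA
    simp only [List.mem_append, List.mem_cons] at hA h1
    rcases hA with hA | rfl | rfl | rfl | hA
    · exact h1 A (Or.inl hA)
    · exact hdiff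
    · exact hint
    · exact hQ
    · exact h1 A (Or.inr (Or.inr (Or.inr hA)))
  · simp only [List.pairwise_append, List.pairwise_cons, List.mem_cons]
    have s1 : P \ M ⊆ P := Finset.sdiff_subset
    have s2 : P ∩ M ⊆ P := Finset.inter_subset_left
    refine ⟨p1, ⟨?_, ?_, p3, p4⟩, ?_⟩
    · rintro B (rfl | hB)
      · rw [Finset.disjoint_left]
        grind
      · exact (p2 B hB).mono_left s1
    · intro B hB
      exact (p2 B hB).mono_left s2
    · rintro A hA B (rfl | rfl | hB)
      · exact (p5 A hA P (Or.inl rfl)).mono_right s1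
      · exact (p5 A hA P (Or.inl rfl)).mono_right s2
      · exact p5 A hA B (Or.inr hB)
  · rw [List.isChain_append]
    refine ⟨c1, ?_, ?_⟩
    · rw [List.isChain_cons_cons, List.isChain_cons_cons]
      exact ⟨hself, hunion, c2.2⟩
    · intro A hA B hB
      simp only [List.head?_cons, Option.mem_def, Option.some.injEq] at hB
      subst hB
      have hAP := c3 A hA P (by simp)
      have hAl := List.mem_of_getLast? hA
      have d1 := Finset.disjoint_left.1 (p5 A hAl P (Or.inl rfl))
      have d2 := Finset.disjoint_left.1 (p5 A hAl Q (Or.inr (Or.inl rfl)))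
      have e : A ∪ (P \ M) = (A ∪ P) \ M := by
        ext v
        have := @hMsub v
        have := @d1 v
        have := @d2 v
        grind
      rw [e]
      obtain ⟨z, hz⟩ := hPM
      have := @d2 q
      have := @hPQ' q
      exact cross_diff hsym hnonneg hAP hM ⟨z, by grind⟩ ⟨q, by grind⟩
  · intro v
    rw [h4]
    simp only [List.mem_append, List.mem_cons]
    constructor
    · rintro ⟨A, hA | rfl | rfl | hA, hv⟩
      · exact ⟨A, Or.inl hA, hv⟩
      · by_cases hvM : v ∈ M
        · exact ⟨A ∩ M, by simp, by grind⟩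
        · exact ⟨A \ M, by simp, by grind⟩
      · exact ⟨A, by simp, hv⟩
      · exact ⟨A, by simp [hA], hv⟩
    · rintro ⟨A, hA | rfl | rfl | rfl | hA, hv⟩
      · exact ⟨A, Or.inl hA, hv⟩
      · exact ⟨P, by simp, by grind⟩
      · exact ⟨P, by simp, by grind⟩
      · exact ⟨A, by simp, hv⟩
      · exact ⟨A, by simp [hA], hv⟩

/-- In a weak chain of maximum length consecutive unions are minimal mincuts of edges. -/
theorem WChain.edge_of_max {w : V → V → ℝ} (hsym : ∀ x y, w x y = w y x)
    (hnonneg : ∀ x y, 0 ≤ w x y) {r : V} {X : Finset V} (hr : r ∉ X)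
    (hX : IsMincut w X) (hpos : 0 < cutVal w X)
    {l₁ l₂ : List (Finset V)} {P Q : Finset V}
    (h : WChain w X (l₁ ++ P :: Q :: l₂))
    (hmax : ∀ L, WChain w X L → L.length ≤ (l₁ ++ P :: Q :: l₂).length) :
    ∃ a b, IsMinimalMincutOfEdge w r a b (P ∪ Q) := by
  have h' := h
  obtain ⟨h1, h2, h3, h4⟩ := h'
  have hP : IsMincut w P := h1 P (by simp)
  have hQ : IsMincut w Q := h1 Q (by simp)
  have hrP : r ∉ P := fun h => hr ((h4 r).2 ⟨P, by simp, h⟩)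
  have hrQ : r ∉ Q := fun h => hr ((h4 r).2 ⟨Q, by simp, h⟩)
  rw [List.isChain_append, List.isChain_cons_cons] at h3
  have hPQ : IsMincut w (P ∪ Q) := h3.2.1.1
  simp only [List.pairwise_append, List.pairwise_cons, List.mem_cons] at h2
  have hd : Disjoint P Q := h2.2.1.1 Q (Or.inl rfl)
  have hu := cutVal_union w hsym P Q hd
  have e1 := hPQ.2 _ hP.1
  have e2 := hX.2 _ hQ.1
  obtain ⟨a, ha, b, hb, hab⟩ := exists_edge_of_cutW_pos w P Q (by linarith)
  refine ⟨a, b, ?_⟩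
  by_contra hno
  have hne : a ≠ b := by
    rintro rfl
    exact Finset.disjoint_left.1 hd ha hb
  unfold IsMinimalMincutOfEdge at hno
  push Not at hno
  obtain ⟨Z, hZ, haZ, hbZ, hrZ, hc⟩ :=
    hno ⟨hne, hab⟩ hPQ (by grind) (by grind) (by grind)
  obtain ⟨M, hM, hMX, haM, hbM⟩ := exists_sub_mincut hnonneg hPQ (r := r) (by grind)
    (by grind) (by grind) hZ hrZ haZ hbZ hc
  by_cases hPM : (P \ M).Nonempty
  · have := hmax _ (h.refine hsym hnonneg hr hM hMX.1 ⟨a, by grind⟩ ⟨b, by grind⟩ hPM)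
    simp at this
  · have hQM : (Q \ M).Nonempty := by
      rw [Finset.sdiff_nonempty] at hPM ⊢
      intro hQM
      exact hMX.2 (Finset.union_subset (not_not.1 hPM) hQM)
    have hrev := h.reverse
    have e : (l₁ ++ P :: Q :: l₂).reverse = l₂.reverse ++ Q :: P :: l₁.reverse := by simp
    rw [e] at hrev
    have := hmax _ (hrev.refine hsym hnonneg hr hM (by rw [Finset.union_comm]; exact hMX.1)
      ⟨b, by grind⟩ ⟨a, by grind⟩ hQM)
    simp at this
    omega

theorem hasCert_of_mincut {w : V → V → ℝ} (hsym : ∀ x y, w x y = w y x)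
    (hnonneg : ∀ x y, 0 ≤ w x y) (r : V) (hpos : ∀ X, IsMincut w X → 0 < cutVal w X)
    (n : ℕ) : ∀ X : Finset V, X.card = n → IsMincut w X → r ∉ X → HasCert w r X := by
  induction n using Nat.strong_induction_on with
  | _ n ih =>
  intro X hn hX hr
  by_cases hv : ∃ v, IsMinimalMincutOfVertex w r v X
  · exact HasCert.vertex hv.choose_spec
  by_cases hE : ∃ a b, IsMinimalMincutOfEdge w r a b X
  · obtain ⟨a, b, h⟩ := hE
    exact HasCert.edge h
  push Not at hv hE
  obtain ⟨P, Q, hP, hQ, hd, hU⟩ := exists_split hsym hnonneg hX hr (hpos X hX) hv hE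
  have hW0 : WChain w X [P, Q] := by
    refine ⟨by simp [hP, hQ], by simpa using hd, by simpa [hU] using hX, ?_⟩
    intro v
    simp [← hU]
  have hex : ∃ L, WChain w X L ∧ ∀ L', WChain w X L' → L'.length ≤ L.length := by
    have hb : BddAbove {k | ∃ L, WChain w X L ∧ L.length = k} :=
      ⟨Fintype.card V, by rintro k ⟨L, hL, rfl⟩; exact hL.length_le⟩
    obtain ⟨L, hL, hLk⟩ := Nat.sSup_mem (s := {k | ∃ L, WChain w X L ∧ L.length = k})
      ⟨_, [P, Q], hW0, rfl⟩ hb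
    exact ⟨L, hL, fun L' hL' => hLk ▸ le_csSup hb ⟨L', hL', rfl⟩⟩
  obtain ⟨L, hL, hmax⟩ := hex
  have hlen : 2 ≤ L.length := hmax _ hW0
  have hXU : X = chainUnion L := by
    ext v
    rw [mem_chainUnion, hL.2.2.2 v]
  have hsub : ∀ A ∈ L, A ⊆ X := fun A hA v hv => (hL.2.2.2 v).2 ⟨A, hA, hv⟩
  have hrL : ∀ A ∈ L, r ∉ A := fun A hA h => hr (hsub A hA h)
  rw [hXU]
  refine HasCert.chain hlen (fun A hA => (hL.1 A hA).1.1) hrL hL.2.1 ?_ ?_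
  · intro A hA
    refine ih A.card ?_ A rfl (hL.1 A hA) (hrL A hA)
    rw [← hn]
    apply Finset.card_lt_card
    refine Finset.ssubset_iff_subset_ne.2 ⟨hsub A hA, ?_⟩
    rintro rfl
    have hall : ∀ B ∈ L, B = A := by
      intro B hB
      by_contra hne
      have : Std.Symm (fun A B : Finset V => Disjoint A B) := ⟨fun _ _ h => h.symm⟩
      have hdis : Disjoint A B := hL.2.1.forall hA hB (Ne.symm hne)
      obtain ⟨v, hvB⟩ := (hL.1 B hB).1.1
      exact Finset.disjoint_left.1 hdis (hsub B hB hvB) hvB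
    match L, hlen, hall, hL with
    | B :: C :: l, _, hall, hL =>
      have hB := hall B (by simp)
      have hC := hall C (by simp)
      have := hL.2.1
      rw [List.pairwise_cons] at this
      have hdis := this.1 C (by simp)
      rw [hB, hC] at hdis
      obtain ⟨v, hvA⟩ := hX.1.1
      exact Finset.disjoint_left.1 hdis hvA hvA
  · intro i hi
    have hdec : L = L.take i ++ L.get ⟨i, Nat.lt_of_succ_lt hi⟩ :: L.get ⟨i + 1, hi⟩ ::
        L.drop (i + 2) := by
      conv_lhs => rw [← List.take_append_drop i L]
      rw [List.drop_eq_getElem_cons (Nat.lt_of_succ_lt hi), List.drop_eq_getElem_cons hi]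
      rfl
    refine WChain.edge_of_max hsym hnonneg hr hX (hpos X hX) (l₁ := L.take i)
      (l₂ := L.drop (i + 2)) ?_ ?_
    · rw [← hdec]
      exact hL
    · rw [← hdec]
      exact hmax

end helpers

/-- if `A` and `B` are crossing mincuts with `r ∉ A` and `A` is the minimal
mincut of an edge `e = {x,y}`, then `e` has exactly one endpoint in `A ∩ B` and the other
in `A ∖ B`; consequently `A` is the union of the chain `(A∖B, A∩B)` or `(A∩B, A∖B)`,
so `A` has a chain certificate. -/
theorem crossing_edge_mincut_gives_chain
    (r : V) (w : V → V → ℝ)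
    (hcard : 1 < Fintype.card V)
    (hsym : ∀ x y, w x y = w y x)
    (hnonneg : ∀ x y, 0 ≤ w x y)
    (hdiag : ∀ x, w x x = 0)
    (A B : Finset V) (hA : IsMincut w A) (hB : IsMincut w B)
    (hcross : Crosses A B) (hrA : r ∉ A)
    (x y : V) (he : IsMinimalMincutOfEdge w r x y A) :
    ((x ∈ A ∩ B ∧ y ∈ A \ B) ∨ (x ∈ A \ B ∧ y ∈ A ∩ B)) ∧
    ((IsMincutChain w r [A \ B, A ∩ B] ∧ chainUnion [A \ B, A ∩ B] = A) ∨
      (IsMincutChain w r [A ∩ B, A \ B] ∧ chainUnion [A ∩ B, A \ B] = A)) ∧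
    (∃ C : List (Finset V), IsMincutChain w r C ∧ chainUnion C = A) := by
  classical
  obtain ⟨c1, c2, c3, c4⟩ := hcross
  have hI : IsMincut w (A ∩ B) := by
    obtain ⟨v, hv⟩ := c4
    exact (cross_inter_union hnonneg hA hB c1 ⟨v, by simpa using hv⟩).1
  have hD : IsMincut w (A \ B) := cross_diff hsym hnonneg hA hB c2 c3
  have he' := he
  obtain ⟨⟨hne, hxy⟩, -, hx, hy, -, hmin⟩ := he'
  have hcI : (A ∩ B).card < A.card := Finset.card_lt_card
    (Finset.ssubset_iff_subset_ne.2 ⟨Finset.inter_subset_left, fun h => by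
      obtain ⟨v, hv⟩ := c2
      grind⟩)
  have hcD : (A \ B).card < A.card := Finset.card_lt_card
    (Finset.ssubset_iff_subset_ne.2 ⟨Finset.sdiff_subset, fun h => by
      obtain ⟨v, hv⟩ := c1
      grind⟩)
  have hfirst : (x ∈ A ∩ B ∧ y ∈ A \ B) ∨ (x ∈ A \ B ∧ y ∈ A ∩ B) := by
    by_cases hxB : x ∈ B <;> by_cases hyB : y ∈ B
    · have := hmin (A ∩ B) hI (by grind) (by grind) (by grind)
      omega
    · left
      grind
    · right
      grind
    · have := hmin (A \ B) hD (by grind) (by grind) (by grind)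
      omega
  have hBpos : 0 < cutVal w B := by
    have key : ∀ a b, a ∈ B → b ∉ B → 0 < w a b → 0 < cutVal w B := by
      intro a b ha hb hab
      unfold cutVal cutW
      refine Finset.sum_pos' (fun i _ => Finset.sum_nonneg fun j _ => hnonneg i j) ⟨a, ha, ?_⟩
      exact Finset.sum_pos' (fun j _ => hnonneg a j) ⟨b, by simpa using hb, hab⟩
    rcases hfirst with ⟨h1, h2⟩ | ⟨h1, h2⟩
    · exact key x y (by grind) (by grind) hxy
    · exact key y x (by grind) (by grind) (by rw [hsym]; exact hxy)
  have hpos : ∀ X, IsMincut w X → 0 < cutVal w X := fun X hX =>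
    lt_of_lt_of_le hBpos (hB.2 _ hX.1)
  have hrI : r ∉ A ∩ B := by grind
  have hrD : r ∉ A \ B := by grind
  have kI := hasCert_of_mincut hsym hnonneg r hpos _ _ rfl hI hrI
  have kD := hasCert_of_mincut hsym hnonneg r hpos _ _ rfl hD hrD
  have hU : (A \ B) ∪ (A ∩ B) = A := Finset.sdiff_union_inter A B
  have hchain : IsMincutChain w r [A \ B, A ∩ B] := by
    refine ⟨by simp, by simp [c1, c2], ?_, ?_, ?_, ?_⟩
    · intro S hS
      simp only [List.mem_cons, List.not_mem_nil, or_false] at hS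
      rcases hS with rfl | rfl
      · exact hrD
      · exact hrI
    · simp only [List.pairwise_cons, List.mem_cons, List.not_mem_nil, or_false]
      refine ⟨?_, by simp⟩
      rintro S rfl
      rw [Finset.disjoint_left]
      grind
    · intro S hS
      simp only [List.mem_cons, List.not_mem_nil, or_false] at hS
      rcases hS with rfl | rfl
      · exact kD
      · exact kI
    · intro i hi
      have : i = 0 := by
        simp at hi
        omega
      subst this
      refine ⟨x, y, ?_⟩
      simp only [List.get_eq_getElem, List.getElem_cons_zero, List.getElem_cons_succ]
      rw [hU]
      exact he
  have hCU : chainUnion [A \ B, A ∩ B] = A := by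
    simp only [chainUnion, List.foldr, Finset.union_empty]
    exact hU
  exact ⟨hfirst, Or.inl ⟨hchain, hCU⟩, _, hchain, hCU⟩
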